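/- arXiv:2309.02601 — 3 statements merged into one kernel-verified Lean document; each statement's English description precedes it below -/
import Mathlib

section
/- For every matching M of G, the max-batch makespan satisfies the identity Cmax_max(M) = Σ_{w∈V} p(w) + s·(n−1) − Σ_{{u,v}∈M} (min(p(u),p(v)) + s). -/
open Finset

/-- `M` is a matching of `G`: a finite set of edges of `G` that are pairwise
vertex-disjoint. -/
def IsMatchingFinset {V : Type*} (G : SimpleGraph V) (M : Finset (Sym2 V)) : Prop :=
  (∀ e ∈ M, e ∈ G.edgeSet) ∧
  (M : Set (Sym2 V)).Pairwise fun e f => ∀ v : V, v ∈ e → v ∉ f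

/-- The max-batch makespan of a matching `M`:
`Σ_{{u,v}∈M} max(p u, p v) + Σ_{w ∈ V∖V_M} p w + s·(n − |M| − 1)`. -/
noncomputable def CmaxMax {V : Type*} [Fintype V] [DecidableEq V]
    (p : V → ℝ) (s : ℝ) (M : Finset (Sym2 V)) : ℝ :=
  (∑ e ∈ M, Sym2.lift ⟨fun u v => max (p u) (p v), fun _ _ => max_comm _ _⟩ e)
    + (∑ w ∈ univ.filter fun w => ∀ e ∈ M, w ∉ e, p w)
    + s * ((Fintype.card V : ℝ) - (M.card : ℝ) - 1)

theorem IsMatchingFinset.sum_covered_add_sum_uncovered {V : Type*} [Fintype V] [DecidableEq V]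
    {G : SimpleGraph V} {M : Finset (Sym2 V)} (hM : IsMatchingFinset G M) (p : V → ℝ) :
    (∑ e ∈ M, ∑ w ∈ e.toFinset, p w) + (∑ w ∈ univ.filter fun w => ∀ e ∈ M, w ∉ e, p w)
      = ∑ w, p w := by
  have hdisj : (M : Set (Sym2 V)).PairwiseDisjoint Sym2.toFinset := by
    intro e he f hf hef
    exact Finset.disjoint_left.2 fun v hve hvf =>
      hM.2 he hf hef v (Sym2.mem_toFinset.1 hve) (Sym2.mem_toFinset.1 hvf)
  have hcompl : (univ.filter fun w => ∀ e ∈ M, w ∉ e) = (M.biUnion Sym2.toFinset)ᶜ := by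
    ext w
    simp
  rw [← sum_biUnion hdisj, hcompl, sum_add_sum_compl]

theorem sum_toFinset_eq_max_add_min {V : Type*} [DecidableEq V] (p : V → ℝ) {u v : V}
    (huv : u ≠ v) :
    ∑ w ∈ s(u, v).toFinset, p w = max (p u) (p v) + min (p u) (p v) := by
  rw [Sym2.toFinset_mk_eq, sum_pair huv, max_add_min]

theorem stmt_0 {V : Type*} [Fintype V] [DecidableEq V] (G : SimpleGraph V)
    (p : V → ℝ) (s : ℝ) (M : Finset (Sym2 V)) (hM : IsMatchingFinset G M) :
    CmaxMax p s M
      = (∑ w, p w) + s * ((Fintype.card V : ℝ) - 1)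
        - ∑ e ∈ M,
            Sym2.lift ⟨fun u v => min (p u) (p v) + s,
              fun u v => by simp [min_comm]⟩ e := by
  have hedge : ∀ e ∈ M,
      Sym2.lift ⟨fun u v => max (p u) (p v), fun _ _ => max_comm _ _⟩ e
        = (∑ w ∈ e.toFinset, p w) + s
          - Sym2.lift ⟨fun u v => min (p u) (p v) + s, fun u v => by simp [min_comm]⟩ e := by
    intro e he
    have hadj := hM.1 e he
    induction e with
    | _ u v =>
      rw [sum_toFinset_eq_max_add_min p (G.mem_edgeSet.1 hadj).ne, Sym2.lift_mk, Sym2.lift_mk]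
      ring
  rw [CmaxMax, sum_congr rfl hedge, sum_sub_distrib, sum_add_distrib, sum_const, nsmul_eq_mul,
    ← hM.sum_covered_add_sum_uncovered p]
  ring
end

section
/- The minimum of Cmax_max(M) over all matchings M of G equals Σ_{w∈V} p(w) + s·(n−1) minus the maximum over all matchings M of G of the weight Σ_{{u,v}∈M} (min(p(u),p(v)) + s); in particular, every matching maximizing the weight Σ_{{u,v}∈M}(min(p(u),p(v))+s) minimizes Cmax_max. -/
open Finset

/-- The weight of a matching `M`: `Σ_{{u,v}∈M} (min(p u, p v) + s)`. -/
noncomputable def matchingWeight {V : Type*} (p : V → ℝ) (s : ℝ)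
    (M : Finset (Sym2 V)) : ℝ :=
  ∑ e ∈ M, Sym2.lift ⟨fun u v => min (p u) (p v) + s, fun u v => by simp [min_comm]⟩ e

/-- The vertices covered by a matching contribute the maxima and the minima of its edges. -/
theorem IsMatchingFinset.sum_covered {V : Type*} [DecidableEq V] {G : SimpleGraph V}
    {M : Finset (Sym2 V)} (hM : IsMatchingFinset G M) (p : V → ℝ) (s : ℝ) :
    (∑ e ∈ M, Sym2.lift ⟨fun u v => max (p u) (p v), fun _ _ => max_comm _ _⟩ e)
      + matchingWeight p s M = (∑ w ∈ M.biUnion Sym2.toFinset, p w) + s * M.card := by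
  have hdisj : (M : Set (Sym2 V)).PairwiseDisjoint Sym2.toFinset := by
    intro e he f hf hef
    rw [Function.onFun, Finset.disjoint_left]
    intro v hv hv'
    rw [Sym2.mem_toFinset] at hv hv'
    exact hM.2 he hf hef v hv hv'
  rw [Finset.sum_biUnion hdisj, matchingWeight, ← Finset.sum_add_distrib,
    mul_comm s, ← nsmul_eq_mul, ← Finset.sum_const, ← Finset.sum_add_distrib]
  refine Finset.sum_congr rfl fun e he => ?_
  have hadj := hM.1 e he
  induction e with
  | _ u v =>
    have huv : u ≠ v := G.ne_of_adj hadj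
    rw [Sym2.toFinset_mk_eq, Finset.sum_pair huv, Sym2.lift_mk, Sym2.lift_mk]
    linarith [max_add_min (p u) (p v)]

theorem IsMatchingFinset.cmaxMax_eq {V : Type*} [Fintype V] [DecidableEq V] {G : SimpleGraph V}
    {M : Finset (Sym2 V)} (hM : IsMatchingFinset G M) (p : V → ℝ) (s : ℝ) :
    CmaxMax p s M
      = (∑ w, p w) + s * ((Fintype.card V : ℝ) - 1) - matchingWeight p s M := by
  have hcompl : (univ.filter fun w => ∀ e ∈ M, w ∉ e) = (M.biUnion Sym2.toFinset)ᶜ := by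
    ext w
    simp
  rw [CmaxMax, hcompl]
  linarith [hM.sum_covered p s, Finset.sum_compl_add_sum (M.biUnion Sym2.toFinset) p]

theorem exists_isMatchingFinset_forall_weight_le {V : Type*} [Fintype V]
    (G : SimpleGraph V) (p : V → ℝ) (s : ℝ) :
    ∃ M : Finset (Sym2 V), IsMatchingFinset G M ∧
      ∀ M' : Finset (Sym2 V), IsMatchingFinset G M' →
        matchingWeight p s M' ≤ matchingWeight p s M :=
  Set.exists_max_image {M | IsMatchingFinset G M} (matchingWeight p s) (Set.toFinite _)
    ⟨∅, by simp [IsMatchingFinset]⟩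

theorem stmt_1 {V : Type*} [Fintype V] [DecidableEq V] (G : SimpleGraph V)
    (p : V → ℝ) (s : ℝ) :
    (sInf {c : ℝ | ∃ M : Finset (Sym2 V), IsMatchingFinset G M ∧ c = CmaxMax p s M}
      = (∑ w, p w) + s * ((Fintype.card V : ℝ) - 1)
        - sSup {w : ℝ | ∃ M : Finset (Sym2 V), IsMatchingFinset G M ∧
            w = matchingWeight p s M})
    ∧ ∀ M : Finset (Sym2 V), IsMatchingFinset G M →
        (∀ M' : Finset (Sym2 V), IsMatchingFinset G M' →
          matchingWeight p s M' ≤ matchingWeight p s M) →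
        ∀ M' : Finset (Sym2 V), IsMatchingFinset G M' →
          CmaxMax p s M ≤ CmaxMax p s M' := by
  have hmin : ∀ M : Finset (Sym2 V), IsMatchingFinset G M →
      (∀ M' : Finset (Sym2 V), IsMatchingFinset G M' →
        matchingWeight p s M' ≤ matchingWeight p s M) →
      ∀ M' : Finset (Sym2 V), IsMatchingFinset G M' → CmaxMax p s M ≤ CmaxMax p s M' := by
    intro M hM hmax M' hM'
    rw [hM.cmaxMax_eq, hM'.cmaxMax_eq]
    linarith [hmax M' hM']
  refine ⟨?_, hmin⟩
  obtain ⟨M, hM, hmax⟩ := exists_isMatchingFinset_forall_weight_le G p s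
  have hleast : IsLeast {c : ℝ | ∃ M, IsMatchingFinset G M ∧ c = CmaxMax p s M}
      (CmaxMax p s M) := by
    refine ⟨⟨M, hM, rfl⟩, ?_⟩
    rintro _ ⟨M', hM', rfl⟩
    exact hmin M hM hmax M' hM'
  have hgreatest : IsGreatest {w : ℝ | ∃ M, IsMatchingFinset G M ∧ w = matchingWeight p s M}
      (matchingWeight p s M) := by
    refine ⟨⟨M, hM, rfl⟩, ?_⟩
    rintro _ ⟨M', hM', rfl⟩
    exact hmax M' hM'
  rw [hleast.csInf_eq, hgreatest.csSup_eq, hM.cmaxMax_eq]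
end

section
/- If s ≥ 0, then the minimum of Cmax_sum(M) over all matchings M of G equals Σ_{w∈V} p(w) + s·(n−1) − s·ν(G), and this minimum is attained at every maximum-cardinality matching of G. -/
open Finset

/-- The matching number `ν(G)`: the maximum cardinality of a matching of `G`. -/
noncomputable def matchingNumber {V : Type*} (G : SimpleGraph V) : ℕ :=
  sSup {k : ℕ | ∃ M : Finset (Sym2 V), IsMatchingFinset G M ∧ M.card = k}

/-- The sum-batch makespan of a matching `M`:
`Σ_{{u,v}∈M} (p u + p v) + Σ_{w ∈ V∖V_M} p w + s·(n − |M| − 1)`. -/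
noncomputable def CmaxSum {V : Type*} [Fintype V] [DecidableEq V]
    (p : V → ℝ) (s : ℝ) (M : Finset (Sym2 V)) : ℝ :=
  (∑ e ∈ M, Sym2.lift ⟨fun u v => p u + p v, fun _ _ => add_comm _ _⟩ e)
    + (∑ w ∈ univ.filter fun w => ∀ e ∈ M, w ∉ e, p w)
    + s * ((Fintype.card V : ℝ) - (M.card : ℝ) - 1)

theorem isMatchingFinset_empty {V : Type*} (G : SimpleGraph V) :
    IsMatchingFinset G (∅ : Finset (Sym2 V)) := by
  simp [IsMatchingFinset]

theorem bddAbove_card_matching {V : Type*} [Fintype V] (G : SimpleGraph V) :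
    BddAbove {k : ℕ | ∃ M : Finset (Sym2 V), IsMatchingFinset G M ∧ M.card = k} := by
  classical
  refine ⟨Fintype.card (Sym2 V), ?_⟩
  rintro _ ⟨M, -, rfl⟩
  exact card_le_univ M

theorem IsMatchingFinset.card_le_matchingNumber {V : Type*} [Fintype V] {G : SimpleGraph V}
    {M : Finset (Sym2 V)} (hM : IsMatchingFinset G M) : M.card ≤ matchingNumber G :=
  le_csSup (bddAbove_card_matching G) ⟨M, hM, rfl⟩

theorem exists_isMatchingFinset_card_eq_matchingNumber {V : Type*} [Fintype V]
    (G : SimpleGraph V) :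
    ∃ M : Finset (Sym2 V), IsMatchingFinset G M ∧ M.card = matchingNumber G :=
  Nat.sSup_mem (s := {k : ℕ | ∃ M : Finset (Sym2 V), IsMatchingFinset G M ∧ M.card = k})
    ⟨0, ∅, isMatchingFinset_empty G, card_empty⟩ (bddAbove_card_matching G)

theorem lift_add_eq_sum_filter_mem {V : Type*} [Fintype V] [DecidableEq V] (p : V → ℝ)
    {e : Sym2 V} (he : ¬ e.IsDiag) :
    Sym2.lift ⟨fun u v => p u + p v, fun _ _ => add_comm _ _⟩ e
      = ∑ w ∈ univ.filter (fun w => w ∈ e), p w := by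
  induction e using Sym2.ind with
  | _ u v =>
    have huv : u ≠ v := by simpa using he
    have hfilter : univ.filter (fun w => w ∈ s(u, v)) = {u, v} := by
      ext w
      simp
    rw [hfilter, sum_pair huv, Sym2.lift_mk]

theorem IsMatchingFinset.sum_edges_add_sum_uncovered {V : Type*} [Fintype V] [DecidableEq V]
    {G : SimpleGraph V} {M : Finset (Sym2 V)} (hM : IsMatchingFinset G M) (p : V → ℝ) :
    (∑ e ∈ M, Sym2.lift ⟨fun u v => p u + p v, fun _ _ => add_comm _ _⟩ e)
      + (∑ w ∈ univ.filter fun w => ∀ e ∈ M, w ∉ e, p w) = ∑ w, p w := by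
  have hdisj : (M : Set (Sym2 V)).PairwiseDisjoint
      fun e => univ.filter (fun w => w ∈ e) := by
    intro e he f hf hef
    refine disjoint_left.2 fun w hwe hwf => ?_
    exact hM.2 he hf hef w (mem_filter.1 hwe).2 (mem_filter.1 hwf).2
  have hcover : M.biUnion (fun e => univ.filter (fun w => w ∈ e))
      = univ.filter fun w => ¬ ∀ e ∈ M, w ∉ e := by
    ext w
    simp
  rw [sum_congr rfl fun e he => lift_add_eq_sum_filter_mem p
      (G.not_isDiag_of_mem_edgeSet (hM.1 e he)),
    ← sum_biUnion hdisj, hcover, add_comm, sum_filter_add_sum_filter_not]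

theorem IsMatchingFinset.cmaxSum_eq {V : Type*} [Fintype V] [DecidableEq V]
    {G : SimpleGraph V} {M : Finset (Sym2 V)} (hM : IsMatchingFinset G M) (p : V → ℝ) (s : ℝ) :
    CmaxSum p s M = (∑ w, p w) + s * ((Fintype.card V : ℝ) - 1) - s * (M.card : ℝ) := by
  rw [CmaxSum, hM.sum_edges_add_sum_uncovered p]
  ring

theorem stmt_3 {V : Type*} [Fintype V] [DecidableEq V] (G : SimpleGraph V)
    (p : V → ℝ) (s : ℝ) (hs : 0 ≤ s) :
    IsLeast {c : ℝ | ∃ M : Finset (Sym2 V), IsMatchingFinset G M ∧ c = CmaxSum p s M}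
      ((∑ w, p w) + s * ((Fintype.card V : ℝ) - 1) - s * (matchingNumber G : ℝ))
    ∧ ∀ M : Finset (Sym2 V), IsMatchingFinset G M → M.card = matchingNumber G →
        CmaxSum p s M
          = (∑ w, p w) + s * ((Fintype.card V : ℝ) - 1)
            - s * (matchingNumber G : ℝ) := by
  refine ⟨⟨?_, ?_⟩, fun M hM hcard => by rw [hM.cmaxSum_eq, hcard]⟩
  · obtain ⟨M, hM, hcard⟩ := exists_isMatchingFinset_card_eq_matchingNumber G
    exact ⟨M, hM, by rw [hM.cmaxSum_eq, hcard]⟩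
  · rintro _ ⟨M, hM, rfl⟩
    rw [hM.cmaxSum_eq]
    have hle : (M.card : ℝ) ≤ matchingNumber G := by exact_mod_cast hM.card_le_matchingNumber
    gcongr
end
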